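/- With V, H, F, A as for the 3-D Navier–Stokes equation on a bounded smooth domain Λ ⊆ ℝ³ and viscosity ν > 0, for all u, v ∈ V: ⟨Au + F(u) − Av − F(v), u − v⟩_{V*,V} ≤ −(ν/2)‖u − v‖_V² + (2¹²/ν⁷)‖v‖_{L⁴(Λ;ℝ³)}⁸ ‖u − v‖_H². -/

import Mathlib

open MeasureTheory

/-- The trilinear form `b(u,v,w) = ∫ ∑ᵢⱼ uⁱ (Dᵢ vʲ) wʲ dx`;
`⟨F(u,v), w⟩_{V*,V} = -b(u,v,w)` where `F(u,v) = -P_H[(u·∇)v]`. -/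
noncomputable def nsTrilinear (d : ℕ)
    (u v w : EuclideanSpace ℝ (Fin d) → EuclideanSpace ℝ (Fin d)) : ℝ :=
  ∫ x, ∑ i, ∑ j, u x i * fderiv ℝ v x (EuclideanSpace.single i 1) j * w x j

/-- The squared (Frobenius) norm of the Jacobian, `|∇v|²(x) = ∑ᵢⱼ (Dᵢ vʲ)²`. -/
noncomputable def gradSq (d : ℕ)
    (v : EuclideanSpace ℝ (Fin d) → EuclideanSpace ℝ (Fin d))
    (x : EuclideanSpace ℝ (Fin d)) : ℝ :=
  ∑ i, ∑ j, (fderiv ℝ v x (EuclideanSpace.single i 1) j) ^ 2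

section

variable {d : ℕ}

lemma sum_mul_apply_single_mul_eq_inner
    (L : EuclideanSpace ℝ (Fin d) →L[ℝ] EuclideanSpace ℝ (Fin d)) (a b : EuclideanSpace ℝ (Fin d)) :
    ∑ i, ∑ j, a i * L (EuclideanSpace.single i 1) j * b j = inner ℝ (L a) b := by
  have ha : a = ∑ i, a i • EuclideanSpace.single i (1 : ℝ) := by
    simpa using ((EuclideanSpace.basisFun (Fin d) ℝ).sum_repr a).symm
  conv_rhs => rw [ha, map_sum, sum_inner]
  refine Finset.sum_congr rfl fun i _ => ?_
  rw [map_smul, inner_smul_left, PiLp.inner_apply, Finset.mul_sum]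
  refine Finset.sum_congr rfl fun j _ => ?_
  simp only [RCLike.inner_apply, conj_trivial]
  ring

lemma nsTrilinear_eq_integral_inner (u v w : EuclideanSpace ℝ (Fin d) → EuclideanSpace ℝ (Fin d)) :
    nsTrilinear d u v w = ∫ x, inner ℝ (fderiv ℝ v x (u x)) (w x) := by
  simp only [nsTrilinear, sum_mul_apply_single_mul_eq_inner]

/-- The operator norm of the Jacobian is at most its Frobenius norm. -/
lemma sq_norm_fderiv_le_gradSq (v : EuclideanSpace ℝ (Fin d) → EuclideanSpace ℝ (Fin d))
    (x : EuclideanSpace ℝ (Fin d)) : ‖fderiv ℝ v x‖ ^ 2 ≤ gradSq d v x := by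
  have hG : 0 ≤ gradSq d v x := Finset.sum_nonneg fun i _ => Finset.sum_nonneg fun j _ => sq_nonneg _
  suffices ‖fderiv ℝ v x‖ ≤ √(gradSq d v x) from
    (pow_le_pow_left₀ (norm_nonneg _) this 2).trans_eq (Real.sq_sqrt hG)
  refine ContinuousLinearMap.opNorm_le_bound _ (Real.sqrt_nonneg _) fun a => ?_
  refine le_of_sq_le_sq ?_ (by positivity)
  rw [mul_pow, Real.sq_sqrt hG]
  set L := fderiv ℝ v x
  have ha : a = ∑ i, a i • EuclideanSpace.single i (1 : ℝ) := by
    simpa using ((EuclideanSpace.basisFun (Fin d) ℝ).sum_repr a).symm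
  have hL (j : Fin d) : L a j = ∑ i, L (EuclideanSpace.single i 1) j * a i := by
    conv_lhs => rw [ha, map_sum]
    simp [mul_comm]
  rw [EuclideanSpace.real_norm_sq_eq, EuclideanSpace.real_norm_sq_eq, gradSq, Finset.sum_comm,
    Finset.sum_mul]
  refine Finset.sum_le_sum fun j _ => ?_
  rw [hL]
  exact Finset.sum_mul_sq_le_sq_mul_sq _ _ _

lemma continuous_gradSq {v : EuclideanSpace ℝ (Fin d) → EuclideanSpace ℝ (Fin d)}
    (hv : ContDiff ℝ 1 v) : Continuous (gradSq d v) := by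
  have := hv.continuous_fderiv one_ne_zero
  unfold gradSq
  fun_prop

lemma hasCompactSupport_gradSq {v : EuclideanSpace ℝ (Fin d) → EuclideanSpace ℝ (Fin d)}
    (hv : HasCompactSupport v) : HasCompactSupport (gradSq d v) := by
  refine (hv.fderiv (𝕜 := ℝ)).mono fun x hx h => hx ?_
  simp [gradSq, h]

lemma integral_sq_norm_fderiv_le_integral_gradSq
    {v : EuclideanSpace ℝ (Fin d) → EuclideanSpace ℝ (Fin d)}
    (hv : ContDiff ℝ 1 v) (hvc : HasCompactSupport v) :
    ∫ x, ‖fderiv ℝ v x‖ ^ 2 ≤ ∫ x, gradSq d v x := by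
  have hv' := hv.continuous_fderiv one_ne_zero
  have hcont : Continuous fun x => ‖fderiv ℝ v x‖ ^ 2 := by fun_prop
  have hc : HasCompactSupport fun x => ‖fderiv ℝ v x‖ ^ 2 :=
    (hvc.fderiv (𝕜 := ℝ)).mono fun x hx h => hx (by simp [h])
  exact integral_mono (hcont.integrable_of_hasCompactSupport hc)
    ((continuous_gradSq hv).integrable_of_hasCompactSupport (hasCompactSupport_gradSq hvc))
    (sq_norm_fderiv_le_gradSq v)

/-- Antisymmetry of the trilinear form in its last two arguments, for divergence-free `u`. -/
lemma nsTrilinear_add_swap {u v w : EuclideanSpace ℝ (Fin d) → EuclideanSpace ℝ (Fin d)}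
    (hu : ContDiff ℝ 1 u) (hv : ContDiff ℝ 1 v) (hw : ContDiff ℝ 1 w) (huc : HasCompactSupport u)
    (hudiv : ∀ x, ∑ i, fderiv ℝ u x (EuclideanSpace.single i 1) i = 0) :
    nsTrilinear d u v w + nsTrilinear d u w v = 0 := by
  have hu' := hu.continuous_fderiv one_ne_zero
  have hv' := hv.continuous_fderiv one_ne_zero
  have hw' := hw.continuous_fderiv one_ne_zero
  have hu0 := hu.continuous
  have hv0 := hv.continuous
  have hw0 := hw.continuous
  have hφ : ContDiff ℝ 1 fun x => inner ℝ (v x) (w x) := hv.inner ℝ hw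
  have hφ' := hφ.continuous_fderiv one_ne_zero
  have hφ0 := hφ.continuous
  have hcoord (i : Fin d) (x e : EuclideanSpace ℝ (Fin d)) :
      fderiv ℝ (fun y => u y i) x e = fderiv ℝ u x e i := by
    have := ((EuclideanSpace.proj (𝕜 := ℝ) i).hasFDerivAt.comp x
      (hu.differentiable one_ne_zero x).hasFDerivAt).fderiv
    exact congrArg (fun T => T e) this
  have hci (i : Fin d) : HasCompactSupport fun x => u x i :=
    huc.comp_left (g := fun y : EuclideanSpace ℝ (Fin d) => y i) rfl
  have hint {T : EuclideanSpace ℝ (Fin d) → ℝ} (hT : Continuous T)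
      (h : ∀ x, u x = 0 → T x = 0) : Integrable T :=
    hT.integrable_of_hasCompactSupport (huc.mono fun x hx hx0 => hx (h x hx0))
  have hsplit : ∀ x, inner ℝ (fderiv ℝ v x (u x)) (w x) + inner ℝ (fderiv ℝ w x (u x)) (v x) =
      ∑ i, u x i * fderiv ℝ (fun y => inner ℝ (v y) (w y)) x (EuclideanSpace.single i 1) := by
    intro x
    have hax : u x = ∑ i, u x i • EuclideanSpace.single i (1 : ℝ) := by
      simpa using ((EuclideanSpace.basisFun (Fin d) ℝ).sum_repr (u x)).symm
    trans fderiv ℝ (fun y => inner ℝ (v y) (w y)) x (u x)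
    · rw [fderiv_inner_apply ℝ (hv.differentiable one_ne_zero x)
        (hw.differentiable one_ne_zero x), real_inner_comm (v x), add_comm]
    · conv_lhs => rw [hax, map_sum]
      simp
  have hparts (i : Fin d) :
      ∫ x, u x i * fderiv ℝ (fun y => inner ℝ (v y) (w y)) x (EuclideanSpace.single i 1) =
        -∫ x, fderiv ℝ u x (EuclideanSpace.single i 1) i * inner ℝ (v x) (w x) := by
    simp_rw [← hcoord]
    apply integral_mul_fderiv_eq_neg_fderiv_mul_of_integrable
    · refine Continuous.integrable_of_hasCompactSupport ?_ ?_
      · simp_rw [hcoord]; fun_prop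
      · exact ((hci i).fderiv_apply (𝕜 := ℝ) _).mul_right
    · exact hint (by fun_prop) fun x hx => by simp [hx]
    · exact hint (by fun_prop) fun x hx => by simp [hx]
    · exact fun x _ => ((EuclideanSpace.proj (𝕜 := ℝ) i).hasFDerivAt.comp x
        (hu.differentiable one_ne_zero x).hasFDerivAt).differentiableAt
    · exact fun x _ => hφ.differentiable one_ne_zero x
  rw [nsTrilinear_eq_integral_inner, nsTrilinear_eq_integral_inner, ← integral_add]
  · simp_rw [hsplit]
    rw [integral_finsetSum _ fun i _ => hint (by fun_prop) fun x hx => by simp [hx]]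
    simp_rw [hparts]
    rw [Finset.sum_neg_distrib, ← integral_finsetSum]
    · simp_rw [← Finset.sum_mul, hudiv]
      simp
    · intro i _
      refine Continuous.integrable_of_hasCompactSupport (by fun_prop) ?_
      simp_rw [← hcoord]
      exact ((hci i).fderiv_apply (𝕜 := ℝ) _).mul_right
  · exact hint (by fun_prop) fun x hx => by simp [hx]
  · exact hint (by fun_prop) fun x hx => by simp [hx]

/-- The cancellation `⟨F(u) - F(v), u - v⟩ = -⟨F(u - v), v⟩`. -/
lemma nsTrilinear_cancellation {u v : EuclideanSpace ℝ (Fin d) → EuclideanSpace ℝ (Fin d)}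
    (hu : ContDiff ℝ 1 u) (hv : ContDiff ℝ 1 v) (huc : HasCompactSupport u)
    (hvc : HasCompactSupport v)
    (hudiv : ∀ x, ∑ i, fderiv ℝ u x (EuclideanSpace.single i 1) i = 0)
    (hvdiv : ∀ x, ∑ i, fderiv ℝ v x (EuclideanSpace.single i 1) i = 0) :
    -nsTrilinear d u u (u - v) + nsTrilinear d v v (u - v) =
      nsTrilinear d (u - v) (u - v) v := by
  have hw : ContDiff ℝ 1 (u - v) := hu.sub hv
  have hu' := hu.continuous_fderiv one_ne_zero
  have hv' := hv.continuous_fderiv one_ne_zero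
  have hw' := hw.continuous_fderiv one_ne_zero
  have hu0 := hu.continuous
  have hv0 := hv.continuous
  have hw0 := hw.continuous
  have hwc : HasCompactSupport (u - v) := huc.sub hvc
  have hfd (x) : fderiv ℝ (u - v) x = fderiv ℝ u x - fderiv ℝ v x :=
    fderiv_sub (hu.differentiable one_ne_zero x) (hv.differentiable one_ne_zero x)
  have hwdiv : ∀ x, ∑ i, fderiv ℝ (u - v) x (EuclideanSpace.single i 1) i = 0 := by
    intro x
    simp [hfd, hudiv, hvdiv]
  have h₁ := nsTrilinear_add_swap hu hw hw huc hudiv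
  have h₂ := nsTrilinear_add_swap hw hv hw hwc hwdiv
  have hint {T : EuclideanSpace ℝ (Fin d) → ℝ} (hT : Continuous T)
      (h : ∀ x, (u - v) x = 0 → T x = 0) : Integrable T :=
    hT.integrable_of_hasCompactSupport (hwc.mono fun x hx hx0 => hx (h x hx0))
  have h₃ : nsTrilinear d u u (u - v) - nsTrilinear d v v (u - v) =
      nsTrilinear d u (u - v) (u - v) + nsTrilinear d (u - v) v (u - v) := by
    simp only [nsTrilinear_eq_integral_inner]
    rw [← integral_sub, ← integral_add]
    · congr 1 with x
      rw [← inner_sub_left, ← inner_add_left]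
      simp [hfd]
    all_goals exact hint (by fun_prop) fun x hx => by simp [hx]
  linarith

end

section Sobolev

open Set Function

variable {ι F : Type*} [Fintype ι] [NormedAddCommGroup F] [NormedSpace ℝ F]

/-- The Gagliardo-Nirenberg-Sobolev inequality with constant one for the Euclidean norm. -/
lemma EuclideanSpace.lintegral_pow_le_pow_lintegral_fderiv {p : ℝ}
    (hp : Real.HolderConjugate (Fintype.card ι) p) {g : EuclideanSpace ℝ ι → F}
    (hg : ContDiff ℝ 1 g) (hgc : HasCompactSupport g) :
    ∫⁻ x, ‖g x‖ₑ ^ p ≤ (∫⁻ x, ‖fderiv ℝ g x‖ₑ) ^ p := by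
  classical
  have : (1 : ℝ) ≤ ↑(Fintype.card ι) - 1 := by
    have hι : (2 : ℝ) ≤ Fintype.card ι := by exact_mod_cast hp.lt
    linarith
  let e : (ι → ℝ) ≃L[ℝ] EuclideanSpace ℝ ι := (EuclideanSpace.equiv ι ℝ).symm
  have he : MeasurePreserving e := PiLp.volume_preserving_toLp ι
  have hfd : Continuous (fderiv ℝ g) := hg.continuous_fderiv one_ne_zero
  have hge : ContDiff ℝ 1 (g ∘ e) := hg.comp e.contDiff
  have hgec : HasCompactSupport (g ∘ e) := hgc.comp_homeomorph e.toHomeomorph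
  rw [← he.lintegral_comp_emb e.toHomeomorph.measurableEmbedding,
    ← he.lintegral_comp_emb e.toHomeomorph.measurableEmbedding]
  calc ∫⁻ x, ‖g (e x)‖ₑ ^ p
      = ∫⁻ x, ∏ _i : ι, ‖g (e x)‖ₑ ^ (1 / (Fintype.card ι - 1 : ℝ)) := by
        congr! 2 with x
        rw [Finset.prod_const, ← ENNReal.rpow_natCast, ← ENNReal.rpow_mul, hp.conjugate_eq,
          Finset.card_univ]
        field_simp
    _ ≤ ∫⁻ x, ∏ i, (∫⁻ t, ‖fderiv ℝ g (e (update x i t))‖ₑ) ^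
          ((1 : ℝ) / (Fintype.card ι - 1 : ℝ)) := ?_
    _ ≤ (∫⁻ x, ‖fderiv ℝ g (e x)‖ₑ) ^ p := by
        apply lintegral_prod_lintegral_pow_le _ hp
        fun_prop
  gcongr with x i
  calc ‖g (e x)‖ₑ
    _ ≤ ∫⁻ t in Iic (x i), ‖deriv ((g ∘ e) ∘ update x i) t‖ₑ := by
        apply le_trans (by simp) (HasCompactSupport.enorm_le_lintegral_Ici_deriv _ _ _)
        · exact hge.comp (by convert! contDiff_update 1 x i)
        · exact hgec.comp_isClosedEmbedding (isClosedEmbedding_update x i)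
    _ ≤ ∫⁻ t, ‖fderiv ℝ g (e (update x i t))‖ₑ := ?_
  gcongr with t
  · exact Measure.restrict_le_self
  have hd : HasDerivAt ((g ∘ e) ∘ update x i)
      (fderiv ℝ g (e (update x i t)) (e (Pi.single i 1))) t :=
    ((hg.differentiable one_ne_zero _).hasFDerivAt.comp _ e.hasFDerivAt).comp_hasDerivAt t
      (hasDerivAt_update x i t)
  rw [hd.deriv]
  refine (ContinuousLinearMap.le_opENorm _ _).trans_eq ?_
  have : ‖e (Pi.single i 1)‖ₑ = 1 := by
    have : ‖e (Pi.single i 1)‖ = 1 := by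
      change ‖EuclideanSpace.single i (1 : ℝ)‖ = 1
      simp
    simp [← ofReal_norm, this]
  rw [this, mul_one]

lemma EuclideanSpace.integral_pow_le_pow_integral_fderiv {p : ℝ}
    (hp : Real.HolderConjugate (Fintype.card ι) p) {g : EuclideanSpace ℝ ι → F}
    (hg : ContDiff ℝ 1 g) (hgc : HasCompactSupport g) :
    ∫ x, ‖g x‖ ^ p ≤ (∫ x, ‖fderiv ℝ g x‖) ^ p := by
  have hp0 : 0 ≤ p := hp.symm.nonneg
  have hp1 : 0 < p := hp.symm.pos
  have hfd : Integrable (fderiv ℝ g) :=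
    (hg.continuous_fderiv one_ne_zero).integrable_of_hasCompactSupport (hgc.fderiv (𝕜 := ℝ))
  have hgi : Integrable fun x => ‖g x‖ ^ p :=
    (hg.continuous.norm.rpow_const fun _ => Or.inr hp0).integrable_of_hasCompactSupport
      (hgc.comp_left (g := fun y : F => ‖y‖ ^ p) (by simp [hp1.ne']))
  have h := EuclideanSpace.lintegral_pow_le_pow_lintegral_fderiv hp hg hgc
  rw [← ofReal_integral_norm_eq_lintegral_enorm hfd,
    ENNReal.ofReal_rpow_of_nonneg (integral_nonneg fun _ => norm_nonneg _) hp0] at h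
  refine (ENNReal.ofReal_le_ofReal_iff (by positivity)).1 (le_trans (le_of_eq ?_) h)
  rw [ofReal_integral_eq_lintegral_ofReal hgi (Filter.Eventually.of_forall fun x => by positivity)]
  congr 1 with x
  rw [← ofReal_norm, ENNReal.ofReal_rpow_of_nonneg (norm_nonneg _) hp0]

end Sobolev

section Ladyzhenskaya

variable {X : Type*} [TopologicalSpace X] [MeasurableSpace X] [OpensMeasurableSpace X]
  {μ : Measure X} [IsFiniteMeasureOnCompacts μ]

lemma sq_integral_mul_le_of_hasCompactSupport {f g : X → ℝ} (hf : Continuous f) (hg : Continuous g)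
    (hfc : HasCompactSupport f) (hgc : HasCompactSupport g) (hf0 : ∀ x, 0 ≤ f x)
    (hg0 : ∀ x, 0 ≤ g x) :
    (∫ x, f x * g x ∂μ) ^ 2 ≤ (∫ x, f x ^ 2 ∂μ) * ∫ x, g x ^ 2 ∂μ := by
  have h := integral_mul_le_Lp_mul_Lq_of_nonneg (μ := μ) Real.HolderConjugate.two_two
    (Filter.Eventually.of_forall hf0) (Filter.Eventually.of_forall hg0)
    (hf.memLp_of_hasCompactSupport hfc) (hg.memLp_of_hasCompactSupport hgc)
  simp only [Real.rpow_two, ← Real.sqrt_eq_rpow] at h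
  have hF : 0 ≤ ∫ x, f x ^ 2 ∂μ := integral_nonneg fun _ => sq_nonneg _
  have hG : 0 ≤ ∫ x, g x ^ 2 ∂μ := integral_nonneg fun _ => sq_nonneg _
  calc (∫ x, f x * g x ∂μ) ^ 2
      ≤ (√(∫ x, f x ^ 2 ∂μ) * √(∫ x, g x ^ 2 ∂μ)) ^ 2 :=
        pow_le_pow_left₀ (integral_nonneg fun x => mul_nonneg (hf0 x) (hg0 x)) h 2
    _ = _ := by rw [mul_pow, Real.sq_sqrt hF, Real.sq_sqrt hG]

lemma integral_rpow_ten_thirds_pow_le {f : X → ℝ} (hf : Continuous f)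
    (hfc : HasCompactSupport f) (hf0 : ∀ x, 0 ≤ f x) :
    (∫ x, f x ^ (10 / 3 : ℝ) ∂μ) ^ 3 ≤ (∫ x, f x ^ 2 ∂μ) * (∫ x, f x ^ 4 ∂μ) ^ 2 := by
  have hc (r : ℝ) (hr : 0 < r) : HasCompactSupport fun x => f x ^ r :=
    hfc.comp_left (g := fun y : ℝ => y ^ r) (Real.zero_rpow hr.ne')
  have hcont (r : ℝ) (hr : 0 < r) : Continuous fun x => f x ^ r :=
    hf.rpow_const fun _ => Or.inr hr.le
  have h := integral_mul_le_Lp_mul_Lq_of_nonneg (μ := μ) (p := 3) (q := 3 / 2)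
    (f := fun x => f x ^ (2 / 3 : ℝ)) (g := fun x => f x ^ (8 / 3 : ℝ))
    ⟨by norm_num, by norm_num, by norm_num⟩
    (Filter.Eventually.of_forall fun x => Real.rpow_nonneg (hf0 x) _)
    (Filter.Eventually.of_forall fun x => Real.rpow_nonneg (hf0 x) _)
    ((hcont _ (by norm_num)).memLp_of_hasCompactSupport (hc _ (by norm_num)))
    ((hcont _ (by norm_num)).memLp_of_hasCompactSupport (hc _ (by norm_num)))
  have h1 (x : X) : f x ^ (2 / 3 : ℝ) * f x ^ (8 / 3 : ℝ) = f x ^ (10 / 3 : ℝ) := by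
    rw [← Real.rpow_add_of_nonneg (hf0 x) (by norm_num) (by norm_num)]
    norm_num
  have h2 (x : X) : (f x ^ (2 / 3 : ℝ)) ^ (3 : ℝ) = f x ^ 2 := by
    rw [← Real.rpow_mul (hf0 x), ← Real.rpow_natCast]
    norm_num
  have h3 (x : X) : (f x ^ (8 / 3 : ℝ)) ^ (3 / 2 : ℝ) = f x ^ 4 := by
    rw [← Real.rpow_mul (hf0 x), ← Real.rpow_natCast]
    norm_num
  simp only [h1, h2, h3] at h
  have hA : 0 ≤ ∫ x, f x ^ 2 ∂μ := integral_nonneg fun _ => sq_nonneg _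
  have hB : 0 ≤ ∫ x, f x ^ 4 ∂μ := integral_nonneg fun x => pow_nonneg (hf0 x) 4
  refine (pow_le_pow_left₀ (integral_nonneg fun x => Real.rpow_nonneg (hf0 x) _) h 3).trans_eq ?_
  rw [mul_pow, ← Real.rpow_mul_natCast hA, ← Real.rpow_mul_natCast hB, ← Real.rpow_natCast _ 2]
  norm_num

/-- A form of the three-dimensional Ladyzhenskaya inequality for vector fields. -/
lemma ladyzhenskaya {F : Type*} [NormedAddCommGroup F] [InnerProductSpace ℝ F]
    {w : EuclideanSpace ℝ (Fin 3) → F} (hw : ContDiff ℝ 1 w) (hwc : HasCompactSupport w) :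
    (∫ x, ‖w x‖ ^ 4) ^ 2 ≤
      (8 / 3) ^ 6 * (∫ x, ‖w x‖ ^ 2) * (∫ x, ‖fderiv ℝ w x‖ ^ 2) ^ 3 := by
  have hw' := hw.continuous_fderiv one_ne_zero
  have hnc : HasCompactSupport fun x => ‖w x‖ := hwc.norm
  have hfc : HasCompactSupport fun x => ‖fderiv ℝ w x‖ := (hwc.fderiv (𝕜 := ℝ)).norm
  have hrc : HasCompactSupport fun x => ‖w x‖ ^ (5 / 3 : ℝ) :=
    hwc.comp_left (g := fun y : F => ‖y‖ ^ (5 / 3 : ℝ)) (by simp)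
  have hrcont : Continuous fun x => ‖w x‖ ^ (5 / 3 : ℝ) :=
    hw.continuous.norm.rpow_const fun _ => Or.inr (by norm_num)
  set Q := ∫ x, ‖w x‖ ^ 4
  set W := ∫ x, ‖w x‖ ^ 2
  set G := ∫ x, ‖fderiv ℝ w x‖ ^ 2
  set R := ∫ x, ‖w x‖ ^ (10 / 3 : ℝ)
  set J := ∫ x, ‖w x‖ ^ (5 / 3 : ℝ) * ‖fderiv ℝ w x‖
  have hQ : 0 ≤ Q := integral_nonneg fun x => by positivity
  have hW : 0 ≤ W := integral_nonneg fun x => by positivity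
  have hG : 0 ≤ G := integral_nonneg fun x => by positivity
  have hJ : 0 ≤ J := integral_nonneg fun x => by positivity
  have hR : 0 ≤ R := integral_nonneg fun x => by positivity
  have hRQ : R ^ 3 ≤ W * Q ^ 2 :=
    integral_rpow_ten_thirds_pow_le hw.continuous.norm hnc fun x => norm_nonneg _
  have hJR : J ^ 2 ≤ R * G := by
    have h := sq_integral_mul_le_of_hasCompactSupport (μ := volume) hrcont hw'.norm hrc hfc
      (fun x => by positivity) fun x => norm_nonneg _
    have h1 (x) : (‖w x‖ ^ (5 / 3 : ℝ)) ^ 2 = ‖w x‖ ^ (10 / 3 : ℝ) := by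
      rw [← Real.rpow_mul_natCast (norm_nonneg _)]
      norm_num
    simpa only [h1] using h
  have hQJ : Q ^ 2 ≤ (8 / 3 * J) ^ 3 := by
    have hg : ContDiff ℝ 1 fun x => ‖w x‖ ^ (8 / 3 : ℝ) := hw.norm_rpow (by norm_num)
    have hgc : HasCompactSupport fun x => ‖w x‖ ^ (8 / 3 : ℝ) :=
      hwc.comp_left (g := fun y : F => ‖y‖ ^ (8 / 3 : ℝ)) (by simp)
    have h := EuclideanSpace.integral_pow_le_pow_integral_fderiv (p := 3 / 2)
      (by rw [Fintype.card_fin]; exact ⟨by norm_num, by norm_num, by norm_num⟩) hg hgc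
    have h1 (x) : ‖‖w x‖ ^ (8 / 3 : ℝ)‖ ^ (3 / 2 : ℝ) = ‖w x‖ ^ 4 := by
      rw [Real.norm_of_nonneg (by positivity), ← Real.rpow_mul (norm_nonneg _),
        ← Real.rpow_natCast]
      norm_num
    simp only [h1] at h
    have h2 : ∫ x, ‖fderiv ℝ (fun x => ‖w x‖ ^ (8 / 3 : ℝ)) x‖ ≤ 8 / 3 * J := by
      rw [← integral_const_mul]
      refine integral_mono
        ((hg.continuous_fderiv one_ne_zero).norm.integrable_of_hasCompactSupport
          (hgc.fderiv (𝕜 := ℝ)).norm)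
        (((hrcont.mul hw'.norm).integrable_of_hasCompactSupport hrc.mul_right).const_mul _)
        fun x => ?_
      refine (norm_fderiv_norm_rpow_le (hw.differentiable one_ne_zero) (by norm_num)).trans_eq ?_
      norm_num [mul_assoc]
    have h3 : Q ≤ (8 / 3 * J) ^ (3 / 2 : ℝ) :=
      h.trans (Real.rpow_le_rpow (integral_nonneg fun _ => norm_nonneg _) h2 (by norm_num))
    refine (pow_le_pow_left₀ hQ h3 2).trans_eq ?_
    rw [← Real.rpow_mul_natCast (by positivity), ← Real.rpow_natCast _ 3]
    norm_num
  rcases hQ.eq_or_lt with h0 | hQpos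
  · rw [← h0, zero_pow two_ne_zero]
    positivity
  refine le_of_mul_le_mul_right ?_ (pow_pos hQpos 2)
  calc Q ^ 2 * Q ^ 2 ≤ (8 / 3 * J) ^ 3 * (8 / 3 * J) ^ 3 := by gcongr
    _ = (8 / 3) ^ 6 * (J ^ 2) ^ 3 := by ring
    _ ≤ (8 / 3) ^ 6 * (R * G) ^ 3 := by gcongr
    _ = (8 / 3) ^ 6 * R ^ 3 * G ^ 3 := by ring
    _ ≤ (8 / 3) ^ 6 * (W * Q ^ 2) * G ^ 3 := by gcongr
    _ = (8 / 3) ^ 6 * W * G ^ 3 * Q ^ 2 := by ring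

end Ladyzhenskaya

lemma pow_eight_le_of_sq_le {T B M Q P W D G c : ℝ} (hT : |T| ≤ B)
    (hW : 0 ≤ W) (hD : 0 ≤ D) (hBM : B ^ 2 ≤ D * M) (hMQ : M ^ 2 ≤ Q * P)
    (hQ : Q ^ 2 ≤ c * W * D ^ 3) (hDG : D ≤ G) (hc : 0 ≤ c := by positivity) :
    T ^ 8 ≤ c * G ^ 7 * (P ^ 2 * W) :=
  calc T ^ 8 = |T| ^ 8 := (Even.pow_abs (by decide) _).symm
    _ ≤ B ^ 8 := pow_le_pow_left₀ (abs_nonneg _) hT 8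
    _ = (B ^ 2) ^ 4 := by ring
    _ ≤ (D * M) ^ 4 := by gcongr
    _ = D ^ 4 * (M ^ 2) ^ 2 := by ring
    _ ≤ D ^ 4 * (Q * P) ^ 2 := by gcongr
    _ = D ^ 4 * Q ^ 2 * P ^ 2 := by ring
    _ ≤ D ^ 4 * (c * W * D ^ 3) * P ^ 2 := by gcongr
    _ = c * D ^ 7 * (P ^ 2 * W) := by ring
    _ ≤ c * G ^ 7 * (P ^ 2 * W) := by gcongr

/-- `|⟨F(w), v⟩| ≤ C ‖w‖_V^{7/4} ‖w‖_H^{1/4} ‖v‖_{L⁴}`, raised to the eighth power. -/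
lemma nsTrilinear_self_pow_le {w v : EuclideanSpace ℝ (Fin 3) → EuclideanSpace ℝ (Fin 3)}
    (hw : ContDiff ℝ 1 w) (hv : Continuous v) (hwc : HasCompactSupport w)
    (hvc : HasCompactSupport v) :
    nsTrilinear 3 w w v ^ 8 ≤ (8 / 3) ^ 6 * (∫ x, gradSq 3 w x) ^ 7 *
      ((∫ x, ‖v x‖ ^ 4) ^ 2 * ∫ x, ‖w x‖ ^ 2) := by
  have hw' := hw.continuous_fderiv one_ne_zero
  have hw0 := hw.continuous
  have hfc : HasCompactSupport fun x => ‖fderiv ℝ w x‖ := (hwc.fderiv (𝕜 := ℝ)).norm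
  have hL := ladyzhenskaya hw hwc
  have hGG := integral_sq_norm_fderiv_le_integral_gradSq hw hwc
  have hB : |nsTrilinear 3 w w v| ≤ ∫ x, ‖fderiv ℝ w x‖ * (‖w x‖ * ‖v x‖) := by
    rw [nsTrilinear_eq_integral_inner, ← Real.norm_eq_abs]
    have hcont : Continuous fun x => ‖fderiv ℝ w x‖ * (‖w x‖ * ‖v x‖) := by fun_prop
    refine norm_integral_le_of_norm_le
      (hcont.integrable_of_hasCompactSupport hfc.mul_right)
      (Filter.Eventually.of_forall fun x => ?_)
    refine (norm_inner_le_norm _ _).trans ?_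
    rw [← mul_assoc]
    gcongr
    exact (fderiv ℝ w x).le_opNorm _
  have h₁ := sq_integral_mul_le_of_hasCompactSupport (μ := volume)
    (f := fun x => ‖fderiv ℝ w x‖) (g := fun x => ‖w x‖ * ‖v x‖) (by fun_prop) (by fun_prop)
    hfc hwc.norm.mul_right (fun x => norm_nonneg _) fun x => by positivity
  have h₂ := sq_integral_mul_le_of_hasCompactSupport (μ := volume)
    (f := fun x => ‖w x‖ ^ 2) (g := fun x => ‖v x‖ ^ 2) (by fun_prop) (by fun_prop)
    (hwc.mono fun x hx h => hx (by simp [h])) (hvc.mono fun x hx h => hx (by simp [h]))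
    (fun x => by positivity) fun x => by positivity
  simp only [mul_pow] at h₁
  simp only [← pow_mul, Nat.reduceMul] at h₂
  exact pow_eight_le_of_sq_le hB
    (integral_nonneg fun x => by positivity) (integral_nonneg fun x => by positivity)
    h₁ h₂ hL hGG

/-- Weighted arithmetic-geometric mean inequality with weights `7/8` and `1/8`. -/
lemma eight_pow_mul_pow_mul_le {a b : ℝ} (ha : 0 ≤ a) (hb : 0 ≤ b) :
    8 ^ 8 * (a ^ 7 * b) ≤ (7 * a + b) ^ 8 := by
  rcases ha.eq_or_lt with rfl | ha
  · simpa using pow_nonneg hb 8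
  have h := one_add_mul_le_pow (a := (b / a - 1) / 8)
    (by have : 0 ≤ b / a := by positivity
        linarith) 8
  have h' : b / a ≤ ((7 * a + b) / (8 * a)) ^ 8 := by
    refine le_trans (le_of_eq ?_) (h.trans_eq ?_)
    · push_cast; ring
    · congr 1; field_simp; ring
  rw [div_pow, mul_pow, div_le_div_iff₀ ha (by positivity)] at h'
  refine le_of_mul_le_mul_right ?_ ha
  linarith

lemma le_of_pow_eight_le {B G K ν : ℝ} (hν : 0 < ν) (hG : 0 ≤ G) (hK : 0 ≤ K)
    (h : B ^ 8 ≤ (8 / 3) ^ 6 * G ^ 7 * K) : B ≤ ν / 2 * G + 2 ^ 12 / ν ^ 7 * K := by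
  refine le_of_pow_le_pow_left₀ (n := 8) (by norm_num) (by positivity) (h.trans ?_)
  have hy := eight_pow_mul_pow_mul_le (a := ν / 14 * G) (b := 2 ^ 12 / ν ^ 7 * K)
    (by positivity) (by positivity)
  calc (8 / 3) ^ 6 * G ^ 7 * K ≤ 8 ^ 8 * 2 ^ 12 / 14 ^ 7 * (G ^ 7 * K) := by
        rw [mul_assoc]
        gcongr
        norm_num
    _ = 8 ^ 8 * ((ν / 14 * G) ^ 7 * (2 ^ 12 / ν ^ 7 * K)) := by field_simp
    _ ≤ _ := hy
    _ = _ := by ring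

/-- Local monotonicity for 3-D Navier–Stokes:
`⟨Au + F(u) - Av - F(v), u - v⟩ ≤ -(ν/2)‖u-v‖_V² + (2¹²/ν⁷)‖v‖_{L⁴}⁸ ‖u-v‖_H²`,
where `⟨Aw, z⟩ = -ν ∫ ∇w·∇z` and `⟨F(w), z⟩ = -b(w,w,z)`. -/
theorem ns3d_local_monotonicity
    (Λ : Set (EuclideanSpace ℝ (Fin 3))) (hΛo : IsOpen Λ)
    (hΛb : Bornology.IsBounded Λ)
    (ν : ℝ) (hν : 0 < ν)
    (u v : EuclideanSpace ℝ (Fin 3) → EuclideanSpace ℝ (Fin 3))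
    (hu : ContDiff ℝ 1 u) (hv : ContDiff ℝ 1 v)
    (hus : tsupport u ⊆ Λ) (hvs : tsupport v ⊆ Λ)
    (hudiv : ∀ x, ∑ i, fderiv ℝ u x (EuclideanSpace.single i 1) i = 0)
    (hvdiv : ∀ x, ∑ i, fderiv ℝ v x (EuclideanSpace.single i 1) i = 0) :
    -ν * (∫ x, gradSq 3 (u - v) x) - nsTrilinear 3 u u (u - v)
        + nsTrilinear 3 v v (u - v) ≤
      -(ν/2) * (∫ x, gradSq 3 (u - v) x) +
        (2^12/ν^7) * (∫ x, ‖v x‖ ^ 4) ^ 2 * ∫ x, ‖u x - v x‖ ^ 2 := by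
  have huc : HasCompactSupport u :=
    Metric.isCompact_of_isClosed_isBounded (isClosed_tsupport u) (hΛb.subset hus)
  have hvc : HasCompactSupport v :=
    Metric.isCompact_of_isClosed_isBounded (isClosed_tsupport v) (hΛb.subset hvs)
  have hcancel := nsTrilinear_cancellation hu hv huc hvc hudiv hvdiv
  have hG : 0 ≤ ∫ x, gradSq 3 (u - v) x :=
    integral_nonneg fun x => (sq_nonneg _).trans (sq_norm_fderiv_le_gradSq _ x)
  have hK : 0 ≤ (∫ x, ‖v x‖ ^ 4) ^ 2 * ∫ x, ‖u x - v x‖ ^ 2 :=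
    mul_nonneg (sq_nonneg _) (integral_nonneg fun x => by positivity)
  have h := le_of_pow_eight_le hν hG hK
    (nsTrilinear_self_pow_le (hu.sub hv) hv.continuous (huc.sub hvc) hvc)
  linarith
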